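/- arXiv:2501.16777 — 7 statements merged into one kernel-verified Lean document; each statement's English description precedes it below -/
import Mathlib

section
/- Let φ be a nonautonomous cocycle on a nonempty finite set X over a probability space (Ω, 𝓕, ℙ). Then the family A is strictly φ-invariant: for all t ≥ t₀ and all ω ∈ Ω one has {φ(t,t₀,a,ω) : a ∈ A(t₀,ω)} = A(t,ω). -/
open MeasureTheory

/-- The set of states reachable at time `t` starting at time `t₀` from all of `X`. -/
def cocycleB {X Ω : Type*} (φ : ℝ → ℝ → X → Ω → X) (t t₀ : ℝ) (ω : Ω) : Set X :=
  Set.range fun x => φ t t₀ x ω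

/-- The candidate pullback attractor `A(t,ω) = ⋂_{t₀ ≤ t} B(t,t₀,ω)`. -/
def cocycleA {X Ω : Type*} (φ : ℝ → ℝ → X → Ω → X) (t : ℝ) (ω : Ω) : Set X :=
  ⋂ t₀ ≤ t, cocycleB φ t t₀ ω

theorem stmt1 {X : Type*} [Fintype X] [Nonempty X]
    {Ω : Type*} [MeasurableSpace Ω] (P : Measure Ω) [IsProbabilityMeasure P]
    (φ : ℝ → ℝ → X → Ω → X)
    (hid : ∀ (t : ℝ) (x : X) (ω : Ω), φ t t x ω = x)
    (hcoc : ∀ (t s t₀ : ℝ), t₀ ≤ s → s ≤ t → ∀ (x : X) (ω : Ω),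
      φ t t₀ x ω = φ t s (φ s t₀ x ω) ω) :
    ∀ (t₀ t : ℝ), t₀ ≤ t → ∀ ω : Ω,
      (fun a => φ t t₀ a ω) '' cocycleA φ t₀ ω = cocycleA φ t ω := by
  intro t₀ t ht ω
  ext y
  simp only [cocycleA, cocycleB, Set.mem_image, Set.mem_iInter, Set.mem_range]
  constructor
  · rintro ⟨a, ha, rfl⟩ s hs
    rcases le_total s t₀ with h | h
    · obtain ⟨x, rfl⟩ := ha s h
      exact ⟨x, hcoc t t₀ s h ht x ω⟩
    · exact ⟨φ s t₀ a ω, (hcoc t s t₀ h hs a ω).symm⟩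
  · intro hy
    by_contra hcon
    have key : ∀ a : X, ∃ s : ℝ, s ≤ t₀ ∧
        (φ t t₀ a ω = y → ¬ ∃ x, φ t₀ s x ω = a) := by
      intro a
      by_cases hay : φ t t₀ a ω = y
      · by_contra hne
        refine hcon ⟨a, fun s hs => ?_, hay⟩
        by_contra hx
        exact hne ⟨s, hs, fun _ => hx⟩
      · exact ⟨t₀, le_rfl, fun h => absurd h hay⟩
    choose s hs hsn using key
    obtain ⟨b, hb⟩ := Finite.exists_min s
    obtain ⟨x, hx⟩ := hy (s b) ((hs b).trans ht)
    rw [hcoc t t₀ (s b) (hs b) ht] at hx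
    exact hsn _ hx ⟨φ (s (φ t₀ (s b) x ω)) (s b) x ω,
      (hcoc t₀ _ (s b) (hb _) (hs _) x ω).symm⟩
end

section
/- Let φ be a nonautonomous cocycle on a nonempty finite set X over a probability space (Ω, 𝓕, ℙ), with ω ↦ φ(t,t₀,x,ω) measurable for all t ≥ t₀ and x ∈ X. Assume that for each p ∈ (0,1) there is T_p > 0 such that ℙ({ω ∈ Ω : B(t, t−T_p, ω) = A(t,ω)}) ≥ p for all t ∈ ℝ. Then for almost every ω ∈ Ω the following holds: for every t₀ ∈ ℝ there exists T(t₀,ω) > t₀ such that B(t,t₀,ω) = A(t,ω) for all t ≥ T(t₀,ω). -/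
open MeasureTheory

theorem B_mono {X Ω : Type*} (φ : ℝ → ℝ → X → Ω → X)
    (hcoc : ∀ (t s t₀ : ℝ), t₀ ≤ s → s ≤ t → ∀ (x : X) (ω : Ω),
      φ t t₀ x ω = φ t s (φ s t₀ x ω) ω) {t s r : ℝ} (h1 : r ≤ s) (h2 : s ≤ t) (ω : Ω) :
    cocycleB φ t r ω ⊆ cocycleB φ t s ω := by
  rintro _ ⟨x, rfl⟩
  exact ⟨φ s r x ω, (hcoc t s r h1 h2 x ω).symm⟩

theorem A_sub {X Ω : Type*} (φ : ℝ → ℝ → X → Ω → X) {t s : ℝ} (h : s ≤ t) (ω : Ω) :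
    cocycleA φ t ω ⊆ cocycleB φ t s ω := Set.biInter_subset_of_mem (show s ∈ {s | s ≤ t} from h)

theorem B_eq_A_iff {X Ω : Type*} (φ : ℝ → ℝ → X → Ω → X)
    (hcoc : ∀ (t s t₀ : ℝ), t₀ ≤ s → s ≤ t → ∀ (x : X) (ω : Ω),
      φ t t₀ x ω = φ t s (φ s t₀ x ω) ω) {t s : ℝ} (h : s ≤ t) (ω : Ω) :
    cocycleB φ t s ω = cocycleA φ t ω ↔
      ∀ (k : ℕ) (x : X), ∃ y, φ t (t - k) y ω = φ t s x ω := by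
  constructor
  · intro he k x
    have : φ t s x ω ∈ cocycleA φ t ω := he ▸ ⟨x, rfl⟩
    exact A_sub φ (by simp : t - (k : ℝ) ≤ t) ω this
  · intro hk
    refine Set.Subset.antisymm ?_ (A_sub φ h ω)
    rintro _ ⟨x, rfl⟩
    refine Set.mem_iInter₂.2 fun r hr => ?_
    obtain ⟨k, hk'⟩ := exists_nat_ge (t - r)
    exact B_mono φ hcoc (by linarith) hr ω (hk k x)

/-- Points of the attractor have preimages in the attractor's past; hence equality propagates. -/
theorem B_eq_A_forward {X Ω : Type*} [Finite X] (φ : ℝ → ℝ → X → Ω → X)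
    (hcoc : ∀ (t s t₀ : ℝ), t₀ ≤ s → s ≤ t → ∀ (x : X) (ω : Ω),
      φ t t₀ x ω = φ t s (φ s t₀ x ω) ω) {t s r : ℝ} (hrs : r ≤ s) (hst : s ≤ t) (ω : Ω)
    (h : cocycleB φ s r ω = cocycleA φ s ω) :
    cocycleB φ t r ω = cocycleA φ t ω := by
  refine Set.Subset.antisymm ?_ (A_sub φ (hrs.trans hst) ω)
  rintro _ ⟨x, rfl⟩
  refine Set.mem_iInter₂.2 fun q hq => ?_
  have hx : φ s r x ω ∈ cocycleA φ s ω := h ▸ ⟨x, rfl⟩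
  obtain ⟨y, hy⟩ := A_sub φ (min_le_right q s) ω hx
  refine B_mono φ hcoc (min_le_left q s) hq ω ⟨y, ?_⟩
  simp only at hy ⊢
  rw [hcoc t s _ (min_le_right q s) hst, hy, hcoc t s r hrs hst]

theorem stmt2 {X : Type*} [Fintype X] [Nonempty X]
    [MeasurableSpace X] [MeasurableSingletonClass X]
    {Ω : Type*} [MeasurableSpace Ω] (P : Measure Ω) [IsProbabilityMeasure P]
    (φ : ℝ → ℝ → X → Ω → X)
    (hid : ∀ (t : ℝ) (x : X) (ω : Ω), φ t t x ω = x)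
    (hcoc : ∀ (t s t₀ : ℝ), t₀ ≤ s → s ≤ t → ∀ (x : X) (ω : Ω),
      φ t t₀ x ω = φ t s (φ s t₀ x ω) ω)
    (hmeas : ∀ (t t₀ : ℝ), t₀ ≤ t → ∀ x : X, Measurable fun ω => φ t t₀ x ω)
    (hunif : ∀ p ∈ Set.Ioo (0 : ℝ) 1, ∃ Tp > 0, ∀ t : ℝ,
      P {ω | cocycleB φ t (t - Tp) ω = cocycleA φ t ω} ≥ ENNReal.ofReal p) :
    ∀ᵐ ω ∂P, ∀ t₀ : ℝ, ∃ T > t₀, ∀ t ≥ T, cocycleB φ t t₀ ω = cocycleA φ t ω := by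
  have key : ∀ n : ℕ, ∀ᵐ ω ∂P, ∃ s > (n : ℝ), cocycleB φ s n ω = cocycleA φ s ω := by
    intro n
    rw [ae_iff]
    refine le_antisymm (ENNReal.le_of_forall_pos_le_add fun ε hε _ => ?_) zero_le
    rw [zero_add]
    have hε' : (0 : ℝ) < ε := hε
    have hm : 0 < min (ε : ℝ) (1 / 2) := lt_min hε' (by norm_num)
    have hm2 : min (ε : ℝ) (1 / 2) ≤ 1 / 2 := min_le_right _ _
    obtain ⟨T, hT, hP⟩ := hunif (1 - min (ε : ℝ) (1 / 2)) ⟨by linarith, by linarith⟩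
    have hP := hP (n + T)
    rw [add_sub_cancel_right] at hP
    set E := {ω | cocycleB φ (n + T) n ω = cocycleA φ (n + T) ω} with hE
    have hle : (n : ℝ) ≤ n + T := by linarith
    have hEm : MeasurableSet E := by
      have : E = ⋂ (k : ℕ), ⋂ (x : X), ⋃ (y : X),
          {ω | φ (n + T) (n + T - k) y ω = φ (n + T) n x ω} := by
        ext ω
        simp only [hE, Set.mem_ofPred_eq, B_eq_A_iff φ hcoc hle ω, Set.mem_iInter, Set.mem_iUnion]
      rw [this]
      exact MeasurableSet.iInter fun k => MeasurableSet.iInter fun x => MeasurableSet.iUnion fun y =>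
        measurableSet_eq_fun (hmeas _ _ (by simp) y) (hmeas _ _ hle x)
    calc P {ω | ¬ ∃ s > (n : ℝ), cocycleB φ s n ω = cocycleA φ s ω} ≤ P Eᶜ :=
          measure_mono fun ω hω hωE => hω ⟨n + T, by linarith, hωE⟩
      _ = 1 - P E := prob_compl_eq_one_sub hEm
      _ ≤ 1 - ENNReal.ofReal (1 - min (ε : ℝ) (1 / 2)) := tsub_le_tsub_left hP 1
      _ = ENNReal.ofReal (min (ε : ℝ) (1 / 2)) := by
          rw [← ENNReal.ofReal_one, ← ENNReal.ofReal_sub _ (by linarith)]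
          congr 1
          ring
      _ ≤ ENNReal.ofReal (ε : ℝ) := ENNReal.ofReal_le_ofReal (min_le_left _ _)
      _ = ε := ENNReal.ofReal_coe_nnreal
  filter_upwards [ae_all_iff.2 key] with ω hω t₀
  obtain ⟨n, hn⟩ := exists_nat_ge t₀
  obtain ⟨s, hs, he⟩ := hω n
  refine ⟨s, by linarith, fun t ht => ?_⟩
  refine Set.Subset.antisymm ?_ (A_sub φ (by linarith) ω)
  rw [← B_eq_A_forward φ hcoc hs.le ht ω he]
  exact B_mono φ hcoc hn (by linarith) ω
end

section
/- Let φ be a nonautonomous cocycle on a nonempty finite set X over a probability space (Ω, 𝓕, ℙ), with ω ↦ φ(t,t₀,x,ω) measurable for all t ≥ t₀ and x ∈ X. Then for every t ∈ ℝ the limit lim_{t₀ → −∞} ℙ(Γ(t,t₀)) exists and equals ℙ({ω ∈ Ω : A(t,ω) is a singleton}). -/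
open MeasureTheory Filter

/-- `Γ(t,t₀)`: the set of `ω` for which all solutions starting at `t₀` coincide at time `t`. -/
def cocycleGamma {X Ω : Type*} (φ : ℝ → ℝ → X → Ω → X) (t t₀ : ℝ) : Set Ω :=
  {ω | ∀ x₁ x₂ : X, φ t t₀ x₁ ω = φ t t₀ x₂ ω}

theorem stmt4 {X : Type*} [Fintype X] [Nonempty X]
    [MeasurableSpace X] [MeasurableSingletonClass X]
    {Ω : Type*} [MeasurableSpace Ω] (P : Measure Ω) [IsProbabilityMeasure P]
    (φ : ℝ → ℝ → X → Ω → X)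
    (hid : ∀ (t : ℝ) (x : X) (ω : Ω), φ t t x ω = x)
    (hcoc : ∀ (t s t₀ : ℝ), t₀ ≤ s → s ≤ t → ∀ (x : X) (ω : Ω),
      φ t t₀ x ω = φ t s (φ s t₀ x ω) ω)
    (hmeas : ∀ (t t₀ : ℝ), t₀ ≤ t → ∀ x : X, Measurable fun ω => φ t t₀ x ω) :
    ∀ t : ℝ, Tendsto (fun t₀ => P (cocycleGamma φ t t₀)) atBot
      (nhds (P {ω | ∃ a : X, cocycleA φ t ω = {a}})) := by
  intro t
  have hB : ∀ ω r s, r ≤ s → s ≤ t → cocycleB φ t r ω ⊆ cocycleB φ t s ω := by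
    rintro ω r s hrs hst _ ⟨x, rfl⟩
    exact ⟨φ s r x ω, (hcoc t s r hrs hst x ω).symm⟩
  have hanti : Antitone (fun s => cocycleGamma φ t (min s t)) := by
    intro r s hrs ω hω x₁ x₂
    have h1 : min r t ≤ min s t := min_le_min_right t hrs
    rw [hcoc t (min s t) (min r t) h1 (min_le_right _ _) x₁ ω,
      hcoc t (min s t) (min r t) h1 (min_le_right _ _) x₂ ω]
    exact hω _ _
  have hS : {ω | ∃ a : X, cocycleA φ t ω = {a}} = ⋃ s, cocycleGamma φ t (min s t) := by
    ext ω
    simp only [Set.mem_setOf_eq, Set.mem_iUnion]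
    constructor
    · rintro ⟨a, ha⟩
      have h : ∀ x : X, ∃ s, s ≤ t ∧ (x ≠ a → x ∉ cocycleB φ t s ω) := by
        intro x
        by_cases hx : x = a
        · exact ⟨t, le_rfl, fun h => absurd hx h⟩
        · have : x ∉ cocycleA φ t ω := by rw [ha]; exact hx
          simp only [cocycleA, Set.mem_iInter, not_forall] at this
          obtain ⟨s, hs, hxs⟩ := this
          exact ⟨s, hs, fun _ => hxs⟩
      choose f hf hfx using h
      obtain ⟨m, hm⟩ := (Set.finite_range f).bddBelow
      have key : ∀ x, φ t (min m t) x ω = a := by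
        intro x
        by_contra hne
        refine hfx _ hne (hB ω (min m t) _ ?_ (hf _) ⟨x, rfl⟩)
        exact (min_le_left _ _).trans (hm ⟨_, rfl⟩)
      exact ⟨m, fun x₁ x₂ => by rw [key, key]⟩
    · rintro ⟨s, hs⟩
      obtain ⟨x₀⟩ := ‹Nonempty X›
      refine ⟨φ t (min s t) x₀ ω, Set.Subset.antisymm ?_ ?_⟩
      · intro y hy
        simp only [cocycleA, Set.mem_iInter] at hy
        obtain ⟨x, rfl⟩ := hy (min s t) (min_le_right _ _)
        exact hs _ _
      · rintro _ rfl
        simp only [cocycleA, Set.mem_iInter]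
        intro r hr
        rcases le_total r (min s t) with h | h
        · refine ⟨x₀, ?_⟩
          change φ t r x₀ ω = _
          rw [hcoc t (min s t) r h (min_le_right _ _) x₀ ω]
          exact hs _ _
        · exact hB ω _ _ h hr ⟨x₀, rfl⟩
  rw [hS]
  refine (tendsto_measure_iUnion_atBot hanti).congr' ?_
  filter_upwards [eventually_le_atBot t] with s hs
  simp [min_eq_left hs]
end

section
/- Let φ be a nonautonomous cocycle on a nonempty finite set X over a probability space (Ω, 𝓕, ℙ). Then for every t ∈ ℝ one has the set identity ⋃_{t₀ < t} Γ(t,t₀) = {ω ∈ Ω : A(t,ω) is a singleton}. -/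
open MeasureTheory

theorem cocycleA_eq_B_aux {X : Type*} [Fintype X] {Ω : Type*}
    (φ : ℝ → ℝ → X → Ω → X)
    (hcoc : ∀ (t s t₀ : ℝ), t₀ ≤ s → s ≤ t → ∀ (x : X) (ω : Ω),
      φ t t₀ x ω = φ t s (φ s t₀ x ω) ω) (t : ℝ) (ω : Ω) :
    ∃ t₁ < t, cocycleA φ t ω = cocycleB φ t t₁ ω := by
  have mono : ∀ r s, r ≤ s → s ≤ t → cocycleB φ t r ω ⊆ cocycleB φ t s ω := by
    rintro r s hrs hst _ ⟨x, rfl⟩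
    exact ⟨φ s r x ω, (hcoc t s r hrs hst x ω).symm⟩
  obtain ⟨_, ⟨t₁, ht₁, rfl⟩, hmin⟩ := (wellFounded_lt (α := Set X)).has_min
    ((fun s => cocycleB φ t s ω) '' Set.Iio t) ⟨_, t - 1, by simp, rfl⟩
  have ht₁ : t₁ < t := ht₁
  refine ⟨t₁, ht₁, Set.Subset.antisymm (Set.iInter₂_subset t₁ ht₁.le)
    (Set.subset_iInter₂ fun s hs => ?_)⟩
  rcases le_total t₁ s with h | h
  · exact mono _ _ h hs
  · by_contra hn
    exact hmin _ ⟨s, h.trans_lt ht₁, rfl⟩ ⟨mono _ _ h ht₁.le, hn⟩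

theorem stmt5 {X : Type*} [Fintype X] [Nonempty X]
    {Ω : Type*} [MeasurableSpace Ω] (P : Measure Ω) [IsProbabilityMeasure P]
    (φ : ℝ → ℝ → X → Ω → X)
    (hid : ∀ (t : ℝ) (x : X) (ω : Ω), φ t t x ω = x)
    (hcoc : ∀ (t s t₀ : ℝ), t₀ ≤ s → s ≤ t → ∀ (x : X) (ω : Ω),
      φ t t₀ x ω = φ t s (φ s t₀ x ω) ω) :
    ∀ t : ℝ, (⋃ t₀ < t, cocycleGamma φ t t₀)
      = {ω | ∃ a : X, cocycleA φ t ω = {a}} := by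
  intro t
  ext ω
  obtain ⟨t₁, ht₁, hA⟩ := cocycleA_eq_B_aux φ hcoc t ω
  simp only [Set.mem_iUnion, Set.mem_setOf_eq]
  constructor
  · rintro ⟨t₀, ht₀, hG⟩
    obtain ⟨x⟩ := ‹Nonempty X›
    have hsub : cocycleA φ t ω ⊆ {φ t t₀ x ω} := by
      refine (Set.iInter₂_subset t₀ ht₀.le).trans ?_
      rintro _ ⟨y, rfl⟩
      exact hG y x
    have hne : (cocycleA φ t ω).Nonempty := hA ▸ ⟨_, x, rfl⟩
    exact ⟨_, (Set.Nonempty.subset_singleton_iff hne).1 hsub⟩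
  · rintro ⟨a, ha⟩
    refine ⟨t₁, ht₁, fun x y => ?_⟩
    have key : ∀ z, φ t t₁ z ω = a := fun z => by
      have hz : φ t t₁ z ω ∈ cocycleB φ t t₁ ω := ⟨z, rfl⟩
      rw [← hA, ha] at hz
      exact hz
    rw [key x, key y]
end

section
/- Let φ be a nonautonomous cocycle on a nonempty finite set X over a probability space (Ω, 𝓕, ℙ), with ω ↦ φ(t,t₀,x,ω) measurable for all t ≥ t₀ and x ∈ X. Then for every t ∈ ℝ and ω ∈ Ω one has A(t,ω) = ⋂_{t₀ ∈ ℚ, t₀ ≤ t} B(t,t₀,ω), and the map ω ↦ A(t,ω), viewed as a map from Ω to the (finite) power set of X, is measurable. -/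
open MeasureTheory

theorem stmt10 {X : Type*} [Fintype X] [Nonempty X]
    [MeasurableSpace X] [MeasurableSingletonClass X]
    {Ω : Type*} [MeasurableSpace Ω] (P : Measure Ω) [IsProbabilityMeasure P]
    (φ : ℝ → ℝ → X → Ω → X)
    (hid : ∀ (t : ℝ) (x : X) (ω : Ω), φ t t x ω = x)
    (hcoc : ∀ (t s t₀ : ℝ), t₀ ≤ s → s ≤ t → ∀ (x : X) (ω : Ω),
      φ t t₀ x ω = φ t s (φ s t₀ x ω) ω)
    (hmeas : ∀ (t t₀ : ℝ), t₀ ≤ t → ∀ x : X, Measurable fun ω => φ t t₀ x ω) :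
    ∀ (t : ℝ),
      (∀ ω : Ω, cocycleA φ t ω = ⋂ (q : ℚ) (_ : (q : ℝ) ≤ t), cocycleB φ t q ω) ∧
      @Measurable Ω (Set X) _ ⊤ (fun ω => cocycleA φ t ω) := by
  intro t
  have hA : ∀ ω : Ω, cocycleA φ t ω = ⋂ (q : ℚ) (_ : (q : ℝ) ≤ t), cocycleB φ t q ω := by
    intro ω
    ext y
    simp only [cocycleA, Set.mem_iInter]
    constructor
    · intro h q hq
      exact h q hq
    · intro h t₀ ht₀
      obtain ⟨q, hq⟩ := exists_rat_lt t₀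
      obtain ⟨x, hx⟩ := h q (hq.le.trans ht₀)
      refine ⟨φ t₀ q x ω, ?_⟩
      simp only at hx ⊢
      rw [← hx]
      exact (hcoc t t₀ q hq.le ht₀ x ω).symm
  refine ⟨hA, ?_⟩
  have hmem : ∀ y : X, MeasurableSet {ω | y ∈ cocycleA φ t ω} := by
    intro y
    have he : {ω | y ∈ cocycleA φ t ω} =
        ⋂ (q : ℚ) (_ : (q : ℝ) ≤ t), ⋃ x : X, (fun ω => φ t q x ω) ⁻¹' {y} := by
      ext ω
      simp [hA, cocycleB]
    rw [he]
    exact MeasurableSet.iInter fun q => MeasurableSet.iInter fun hq =>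
      MeasurableSet.iUnion fun x => hmeas t q hq x (measurableSet_singleton y)
  let _ : MeasurableSpace (Set X) := ⊤
  refine measurable_to_countable' fun S => ?_
  have he : (fun ω => cocycleA φ t ω) ⁻¹' {S} =
      ⋂ y : X, {ω | y ∈ cocycleA φ t ω ↔ y ∈ S} := by
    ext ω
    simp [Set.ext_iff]
  rw [he]
  refine MeasurableSet.iInter fun y => ?_
  by_cases hy : y ∈ S
  · simpa [hy] using hmem y
  · simp only [hy, iff_false]
    exact (hmem y).compl
end

section
/- Let φ be a nonautonomous cocycle on a nonempty finite set X over a probability space (Ω, 𝓕, ℙ). Fix t₀ ∈ ℝ, T > 0 and ω ∈ Ω, and suppose B(t₀+T, t₀, ω) = A(t₀+T, ω). Then B(t, t₀, ω) = A(t, ω) for all t ≥ t₀ + T. -/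
open MeasureTheory

theorem stmt11 {X : Type*} [Fintype X] [Nonempty X]
    {Ω : Type*} [MeasurableSpace Ω] (P : Measure Ω) [IsProbabilityMeasure P]
    (φ : ℝ → ℝ → X → Ω → X)
    (hid : ∀ (t : ℝ) (x : X) (ω : Ω), φ t t x ω = x)
    (hcoc : ∀ (t s t₀ : ℝ), t₀ ≤ s → s ≤ t → ∀ (x : X) (ω : Ω),
      φ t t₀ x ω = φ t s (φ s t₀ x ω) ω)
    (t₀ T : ℝ) (hT : 0 < T) (ω : Ω)
    (h : cocycleB φ (t₀ + T) t₀ ω = cocycleA φ (t₀ + T) ω) :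
    ∀ t ≥ t₀ + T, cocycleB φ t t₀ ω = cocycleA φ t ω := by
  intro t ht
  apply Set.Subset.antisymm
  · rintro y ⟨x, rfl⟩
    simp only [cocycleA, Set.mem_iInter]
    intro s hs
    by_cases hc : s ≤ t₀ + T
    · have hm : φ (t₀ + T) t₀ x ω ∈ cocycleA φ (t₀ + T) ω := by
        rw [← h]
        exact ⟨x, rfl⟩
      simp only [cocycleA, Set.mem_iInter] at hm
      obtain ⟨z, hz⟩ := hm s hc
      refine ⟨z, ?_⟩
      simp only at hz ⊢
      rw [hcoc t (t₀ + T) s hc ht, hz, ← hcoc t (t₀ + T) t₀ (by linarith) ht]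
    · refine ⟨φ s t₀ x ω, ?_⟩
      exact (hcoc t s t₀ (by linarith) hs x ω).symm
  · intro y hy
    simp only [cocycleA, Set.mem_iInter] at hy
    exact hy t₀ (by linarith)
end

section
/- Fix n ≥ 1 and consider the TASEP single-hop map f on X = {0,1}ⁿ. Let (k₁,…,k_m) with m = n(n+1)/2 be the concatenation of the blocks (n), (n−1, n), (n−2, n−1, n), …, (1, 2, …, n), i.e., for j = 1,…,n the j-th block is the increasing sequence (n−j+1, n−j+2, …, n). Then for every state x ∈ {0,1}ⁿ one has F_{(k₁,…,k_m)}(x) = (0,0,…,0). -/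
/-- The TASEP single-hop map on `{0,1}ⁿ` (sites indexed `1,…,n`, here `Fin n` with
site `k` corresponding to index `k-1`).  `k = 0` is entry, `k = n` is exit, and for
`1 ≤ k ≤ n-1` a particle hops from site `k` to site `k+1` provided `s_k = 1` and
`s_{k+1} = 0`; otherwise the state is unchanged. -/
def hop (n : ℕ) (k : ℕ) (x : Fin n → Bool) : Fin n → Bool := fun i =>
  if k = 0 then (if (i : ℕ) = 0 then true else x i)
  else if k = n then (if (i : ℕ) + 1 = n then false else x i)
  else if h : 1 ≤ k ∧ k < n then
    (if x ⟨k - 1, by omega⟩ = true ∧ x ⟨k, h.2⟩ = false then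
      (if (i : ℕ) = k - 1 then false else if (i : ℕ) = k then true else x i)
     else x i)
  else x i

/-- Successive application of the hops `k₁`, then `k₂`, …, then `k_m`. -/
def hopSeq (n : ℕ) (ks : List ℕ) (x : Fin n → Bool) : Fin n → Bool :=
  ks.foldl (fun y k => hop n k y) x

/-- The concatenation of the blocks `(n), (n-1, n), (n-2, n-1, n), …, (1, 2, …, n)`:
the `j`-th block (`j = 1,…,n`) is the increasing sequence `(n-j+1, n-j+2, …, n)`.
It has total length `n(n+1)/2`. -/
def emptyingSeq (n : ℕ) : List ℕ :=
  (List.range n).flatMap fun j => (List.range (j + 1)).map fun i => n - j + i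

theorem block_inv (n j : ℕ) (hj : j < n) (x : Fin n → Bool)
    (hx : ∀ i : Fin n, n - j ≤ (i : ℕ) → x i = false) (m : ℕ) (hm : m ≤ j + 1) :
    ∀ i : Fin n, n - j - 1 ≤ (i : ℕ) → (i : ℕ) ≠ n - j - 1 + m →
      hopSeq n ((List.range m).map fun i => n - j + i) x i = false := by
  induction m with
  | zero =>
    intro i h1 h2
    simpa [hopSeq] using hx i (by omega)
  | succ m ih =>
    intro i h1 h2
    have ih := ih (by omega)
    simp only [hopSeq, List.range_succ, List.map_append, List.foldl_append, List.map_cons,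
      List.map_nil, List.foldl_cons, List.foldl_nil] at ih ⊢
    generalize List.foldl (fun y k => hop n k y) x
      (List.map (fun i => n - j + i) (List.range m)) = y at ih ⊢
    unfold hop
    rw [if_neg (by omega)]
    by_cases hn : n - j + m = n
    · rw [if_pos hn]
      split_ifs with h
      · rfl
      · exact ih i h1 (by omega)
    · rw [if_neg hn, dif_pos (by omega)]
      have hk := ih ⟨n - j + m, by omega⟩ (by simp only; omega) (by simp only; omega)
      by_cases hi : (i : ℕ) = n - j + m - 1
      · have e : i = ⟨n - j + m - 1, by omega⟩ := Fin.ext hi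
        rw [← e]
        simp [hk, hi]
      · have := ih i h1 (by omega)
        have h3 : (i : ℕ) ≠ n - j + m := by omega
        simp [hi, h3, this]

theorem blocks_inv (n : ℕ) (x : Fin n → Bool) (j : ℕ) (hj : j ≤ n) :
    ∀ i : Fin n, n - j ≤ (i : ℕ) →
      hopSeq n ((List.range j).flatMap fun j => (List.range (j + 1)).map fun i => n - j + i) x i
        = false := by
  induction j with
  | zero => intro i h; omega
  | succ j ih =>
    intro i h
    have := block_inv n j (by omega) _ (ih (by omega)) (j + 1) le_rfl i (by omega) (by omega)
    rw [List.range_succ, List.flatMap_append]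
    simpa [hopSeq, List.foldl_append] using this

theorem stmt14 (n : ℕ) (hn : 1 ≤ n) (x : Fin n → Bool) :
    hopSeq n (emptyingSeq n) x = fun _ => false := by
  funext i
  exact blocks_inv n x n le_rfl i (by omega)
end
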